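/- Let J ⊆ I and i ∈ I. For w ∈ W define s_i ∘_l^J w = s_i w if s_i w ≤^J w, and s_i ∘_l^J w = w otherwise. If v, w ∈ W satisfy v ≤^J w, then s_i ∘_l^J v ≤^J s_i ∘_l^J w. -/

import Mathlib

/-!
Common definitions: Bruhat order, standard parabolic subgroups, minimal coset
representatives, the J-Bruhat (twisted) order and J-length, chains and
EL-labeling machinery, for a Coxeter system `cs : CoxeterSystem M W`.
-/

open scoped Classical

namespace TwistedTP

/-- A chain (list) realizing consecutive `r`-steps starting at `a` and ending at `b`. -/
def IsChainFrom {α : Type*} (r : α → α → Prop) (c : List α) (a b : α) : Prop :=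
  c.head? = some a ∧ c.getLast? = some b ∧ c.Chain' r

/-- The word of labels attached to the consecutive pairs of a list.
For a list `z₀ :: z₁ :: ⋯` (written from top to bottom in a descending chain),
the entries are `lab z₁ z₀, lab z₂ z₁, …`, i.e. `lab` is applied to each
covering pair `(lower, upper)`. -/
def labelWord {α Λ : Type*} (lab : α → α → Λ) : List α → List Λ
  | a :: b :: rest => lab b a :: labelWord lab (b :: rest)
  | _ => []

variable {B : Type*} {W : Type*} [Group W] {M : CoxeterMatrix B}
variable (cs : CoxeterSystem M W)

/-- The (strong) Bruhat order on `W`: `v ≤ w` iff some reduced word for `w`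
has a sublist whose product is `v`. -/
def bruhatLE (v w : W) : Prop :=
  ∃ ω : List B, cs.IsReduced ω ∧ cs.wordProd ω = w ∧
    ∃ ω' : List B, ω'.Sublist ω ∧ cs.wordProd ω' = v

def bruhatLT (v w : W) : Prop := bruhatLE cs v w ∧ v ≠ w

def bruhatCovBy (v w : W) : Prop :=
  bruhatLT cs v w ∧ ¬ ∃ z, bruhatLT cs v z ∧ bruhatLT cs z w

/-- The standard parabolic subgroup `W_J`. -/
def parabolic (J : Set B) : Subgroup W := Subgroup.closure (cs.simple '' J)

lemma exists_minRep (J : Set B) (w : W) :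
    ∃ u : W, u⁻¹ * w ∈ parabolic cs J ∧
      ∀ x : W, x⁻¹ * w ∈ parabolic cs J → cs.length u ≤ cs.length x := by
  have hne : (cs.length '' {x : W | x⁻¹ * w ∈ parabolic cs J}).Nonempty :=
    ⟨cs.length w, w, by simpa using (parabolic cs J).one_mem, rfl⟩
  obtain ⟨n, hn, hmin⟩ := Nat.lt_wfRel.wf.has_min _ hne
  obtain ⟨u, hu, rfl⟩ := hn
  refine ⟨u, hu, fun x hx => ?_⟩
  by_contra h
  exact hmin _ ⟨x, hx, rfl⟩ (Nat.lt_of_not_le h)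

/-- The minimal-length representative `w^J` of the coset `w W_J`. -/
noncomputable def minRep (J : Set B) (w : W) : W := (exists_minRep cs J w).choose

/-- The parabolic part `w_J = (w^J)⁻¹ w ∈ W_J` of `w`. -/
noncomputable def parPart (J : Set B) (w : W) : W := (minRep cs J w)⁻¹ * w

/-- The J-Bruhat (twisted) order `≤^J` on `W`:
`v ≤^J w` iff there is `u ∈ W_J` with `v^J u ≤ w^J` and `w_J ≤ u⁻¹ v_J`. -/
def twistedLE (J : Set B) (v w : W) : Prop :=
  ∃ u ∈ parabolic cs J,
    bruhatLE cs (minRep cs J v * u) (minRep cs J w) ∧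
    bruhatLE cs (parPart cs J w) (u⁻¹ * parPart cs J v)

def twistedLT (J : Set B) (v w : W) : Prop := twistedLE cs J v w ∧ v ≠ w

def twistedCovBy (J : Set B) (v w : W) : Prop :=
  twistedLT cs J v w ∧ ¬ ∃ z, twistedLT cs J v z ∧ twistedLT cs J z w

/-- The J-length `ℓ^J(w) = ℓ(w^J) - ℓ(w_J)` (an integer). -/
noncomputable def twistedLength (J : Set B) (w : W) : ℤ :=
  (cs.length (minRep cs J w) : ℤ) - (cs.length (parPart cs J w) : ℤ)



/-- The operation `s_i ∘_l^J w`: it equals `s_i w` if `s_i w ≤^J w`, and `w`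
otherwise. -/
noncomputable def circL (J : Set B) (i : B) (w : W) : W :=
  if twistedLE cs J (cs.simple i * w) w then cs.simple i * w else w

/-! ### The inversion cocycle and the strong exchange property -/

/-- The involution `(t, ε) ↦ (sᵢ t sᵢ, ε + [t = sᵢ])` of `W × ZMod 2`. -/
noncomputable def signedConj (i : B) : Equiv.Perm (W × ZMod 2) :=
  Function.Involutive.toPerm
    (fun p => (cs.simple i * p.1 * cs.simple i, p.2 + if p.1 = cs.simple i then 1 else 0)) (by
      rintro ⟨t, e⟩
      have h : cs.simple i * t * cs.simple i = cs.simple i ↔ t = cs.simple i := by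
        constructor
        · intro h
          have h2 := congrArg (fun x => cs.simple i * x * cs.simple i) h
          simpa [mul_assoc] using h2
        · rintro rfl
          simp
      ext
      · simp [mul_assoc]
      · simp only [h, add_assoc, CharTwo.add_self_eq_zero, add_zero])

lemma signedConj_apply (i : B) (p : W × ZMod 2) :
    signedConj cs i p =
      (cs.simple i * p.1 * cs.simple i, p.2 + if p.1 = cs.simple i then 1 else 0) := rfl

lemma signedConj_mul_pow_apply (i j : B) (k : ℕ) (t : W) (e : ZMod 2) :
    ((signedConj cs i * signedConj cs j) ^ k) (t, e) =
      ((cs.simple i * cs.simple j) ^ k * t * ((cs.simple i * cs.simple j) ^ k)⁻¹,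
        e + ∑ n ∈ Finset.range (2 * k),
          if t = cs.simple j * (cs.simple i * cs.simple j) ^ n then 1 else 0) := by
  induction k with
  | zero => simp
  | succ k ih =>
    have hsc : ∀ l : ℕ, cs.simple j * (cs.simple i * cs.simple j) ^ l =
        ((cs.simple i * cs.simple j) ^ l)⁻¹ * cs.simple j := by
      intro l
      induction l with
      | zero => simp
      | succ l ihl =>
        rw [pow_succ, ← mul_assoc, ihl, ← pow_succ, pow_succ', mul_inv_rev]
        simp only [mul_assoc, mul_inv_rev, cs.inv_simple]
    have h1 : (cs.simple i * cs.simple j) ^ k * t * ((cs.simple i * cs.simple j) ^ k)⁻¹ =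
          cs.simple j ↔ t = cs.simple j * (cs.simple i * cs.simple j) ^ (2 * k) := by
      rw [two_mul, pow_add, ← mul_assoc, hsc, mul_inv_eq_iff_eq_mul, ← eq_inv_mul_iff_mul_eq,
        mul_assoc]
    have h2 : cs.simple j * ((cs.simple i * cs.simple j) ^ k * t *
          ((cs.simple i * cs.simple j) ^ k)⁻¹) * cs.simple j =
          cs.simple i ↔ t = cs.simple j * (cs.simple i * cs.simple j) ^ (2 * k + 1) := by
      have hr : cs.simple j * (cs.simple i * cs.simple j) ^ (2 * k + 1) =
          ((cs.simple i * cs.simple j) ^ k)⁻¹ * (cs.simple j * cs.simple i * cs.simple j) *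
            (cs.simple i * cs.simple j) ^ k := by
        rw [show 2 * k + 1 = k + (1 + k) by ring, pow_add, ← mul_assoc, hsc, pow_add, pow_one]
        simp only [mul_assoc]
      rw [hr]
      generalize (cs.simple i * cs.simple j) ^ k = g
      constructor
      · intro h
        rw [← h]
        simp [mul_assoc]
      · rintro rfl
        simp [mul_assoc]
    rw [pow_succ', Equiv.Perm.mul_apply, ih, Equiv.Perm.mul_apply, signedConj_apply,
      signedConj_apply]
    simp only [h1, h2]
    rw [show 2 * (k + 1) = 2 * k + 1 + 1 by ring, Finset.sum_range_succ, Finset.sum_range_succ]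
    ext
    · simp [pow_succ', mul_assoc]
    · simp [add_assoc]

lemma isLiftable_signedConj : M.IsLiftable (signedConj cs) := by
  intro i j
  ext1 ⟨t, e⟩
  have hc : (cs.simple i * cs.simple j) ^ M i j = 1 := cs.simple_mul_simple_pow i j
  rw [signedConj_mul_pow_apply, hc, two_mul, Finset.sum_range_add]
  simp [pow_add, hc, CharTwo.add_self_eq_zero]

/-- The parity of the number of occurrences of `t` in the left inversion sequence of any word
for `w`. -/
noncomputable def invParity (w t : W) : ZMod 2 :=
  (cs.lift ⟨signedConj cs, isLiftable_signedConj cs⟩ w⁻¹ (t, 0)).2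

lemma lift_signedConj_apply (w t : W) (e : ZMod 2) :
    cs.lift ⟨signedConj cs, isLiftable_signedConj cs⟩ w⁻¹ (t, e) =
      (w⁻¹ * t * w, e + invParity cs w t) := by
  induction w using cs.simple_induction_left generalizing t e with
  | one => simp [invParity]
  | mul_simple_left w i ih =>
    have key : ∀ e, cs.lift ⟨signedConj cs, isLiftable_signedConj cs⟩ (cs.simple i * w)⁻¹ (t, e) =
        ((cs.simple i * w)⁻¹ * t * (cs.simple i * w),
          e + ((if t = cs.simple i then 1 else 0) +
            invParity cs w (cs.simple i * t * cs.simple i))) := by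
      intro e
      rw [mul_inv_rev, map_mul, cs.inv_simple, Equiv.Perm.mul_apply, cs.lift_apply_simple,
        signedConj_apply, ih]
      simp [mul_assoc, add_assoc]
    rw [key, invParity.eq_1 cs (cs.simple i * w), key, zero_add]

lemma invParity_mul (v w t : W) :
    invParity cs (v * w) t = invParity cs v t + invParity cs w (v⁻¹ * t * v) := by
  have h := lift_signedConj_apply cs (v * w) t 0
  rw [mul_inv_rev, map_mul, Equiv.Perm.mul_apply, lift_signedConj_apply,
    lift_signedConj_apply] at h
  simpa using (congrArg Prod.snd h).symm

lemma invParity_one (t : W) : invParity cs 1 t = 0 := by simp [invParity]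

lemma invParity_simple (i : B) (t : W) :
    invParity cs (cs.simple i) t = if t = cs.simple i then 1 else 0 := by
  simp [invParity, cs.inv_simple, signedConj_apply]

lemma invParity_inv (w t : W) : invParity cs w⁻¹ (w⁻¹ * t * w) = invParity cs w t := by
  have h := invParity_mul cs w w⁻¹ t
  rw [mul_inv_cancel, invParity_one] at h
  exact (CharTwo.add_eq_zero.mp h.symm).symm

lemma invParity_self {t : W} (ht : cs.IsReflection t) : invParity cs t t = 1 := by
  obtain ⟨w, i, rfl⟩ := ht
  have h := invParity_inv cs w (w * cs.simple i * w⁻¹)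
  rw [invParity_mul, invParity_mul]
  simp only [mul_assoc, mul_inv_rev, inv_mul_cancel_left, inv_mul_cancel, mul_one,
    cs.inv_simple, cs.simple_mul_simple_cancel_left] at h ⊢
  rw [h, invParity_simple, if_pos rfl, add_right_comm, CharTwo.add_self_eq_zero, zero_add]

lemma mem_leftInvSeq_of_invParity {ω : List B} {t : W}
    (h : invParity cs (cs.wordProd ω) t = 1) : t ∈ cs.leftInvSeq ω := by
  induction ω generalizing t with
  | nil => simp [invParity_one] at h
  | cons i ω ih =>
    rw [cs.wordProd_cons, invParity_mul, invParity_simple] at h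
    rw [CoxeterSystem.leftInvSeq, List.mem_cons]
    by_cases hti : t = cs.simple i
    · exact Or.inl hti
    · rw [if_neg hti, zero_add] at h
      exact Or.inr (List.mem_map.mpr ⟨_, ih h, by simp [mul_assoc]⟩)

lemma invParity_eq_one_iff {t : W} (ht : cs.IsReflection t) (w : W) :
    invParity cs w t = 1 ↔ cs.length (t * w) < cs.length w := by
  have key : ∀ w, invParity cs w t = 1 → cs.length (t * w) < cs.length w := by
    intro w h
    obtain ⟨ω, hω, rfl⟩ := cs.exists_isReduced w
    exact (cs.isLeftInversion_of_mem_leftInvSeq hω (mem_leftInvSeq_of_invParity cs h)).2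
  refine ⟨key w, fun h => ?_⟩
  by_contra hn
  have h0 : invParity cs w t = 0 := by
    generalize invParity cs w t = a at hn
    revert hn; revert a; decide
  have h1 : invParity cs (t * w) t = 1 := by
    rw [invParity_mul, invParity_self cs ht]
    simp [h0]
  have := key _ h1
  rw [← mul_assoc, ht.mul_self, one_mul] at this
  omega

lemma invParity_eq_zero_iff {t : W} (ht : cs.IsReflection t) (w : W) :
    invParity cs w t = 0 ↔ cs.length w < cs.length (t * w) := by
  have h1 := invParity_eq_one_iff cs ht w
  have h2 := ht.length_mul_right_ne w
  have h3 : ∀ a : ZMod 2, a = 0 ↔ ¬ a = 1 := by decide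
  rw [h3, h1]
  omega

/-- The strong exchange property. -/
lemma strong_exchange {t : W} (ht : cs.IsReflection t) {ω : List B}
    (h : cs.length (t * cs.wordProd ω) < cs.length (cs.wordProd ω)) :
    ∃ j < ω.length, t * cs.wordProd ω = cs.wordProd (ω.eraseIdx j) := by
  have hm := mem_leftInvSeq_of_invParity cs ((invParity_eq_one_iff cs ht _).2 h)
  obtain ⟨j, hj, rfl⟩ := List.mem_iff_getElem.mp hm
  refine ⟨j, by simpa using hj, ?_⟩
  rw [← cs.getD_leftInvSeq_mul_wordProd, List.getD_eq_getElem _ _ hj]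

lemma simple_mul_eq_mul_simple {i j : B} {u : W}
    (h1 : cs.length u < cs.length (cs.simple i * u))
    (h2 : cs.length (cs.simple i * (u * cs.simple j)) < cs.length (u * cs.simple j)) :
    cs.simple i * u = u * cs.simple j := by
  have hi := cs.isReflection_simple i
  rw [← invParity_eq_zero_iff cs hi] at h1
  rw [← invParity_eq_one_iff cs hi, invParity_mul, h1, zero_add, invParity_simple] at h2
  have h3 : u⁻¹ * cs.simple i * u = cs.simple j := by
    by_contra hn
    simp [hn] at h2
  rw [← h3]
  group

lemma length_inv_mul_lt {i : B} {u b : W} (hu : cs.length u < cs.length (cs.simple i * u))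
    (hb : cs.length b < cs.length (cs.simple i * b)) :
    cs.length (u⁻¹ * b) < cs.length (u⁻¹ * (cs.simple i * b)) := by
  have hi := cs.isReflection_simple i
  have ht : cs.IsReflection (u⁻¹ * cs.simple i * u) := by simpa using hi.conj u⁻¹
  have e : u⁻¹ * (cs.simple i * b) = (u⁻¹ * cs.simple i * u) * (u⁻¹ * b) := by group
  rw [e, ← invParity_eq_zero_iff cs ht, invParity_mul, invParity_inv,
    (invParity_eq_zero_iff cs hi u).2 hu, zero_add]
  convert (invParity_eq_zero_iff cs hi b).2 hb using 2
  group

/-! ### Properties of the Bruhat order -/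

/-- One upward step of the Bruhat graph. -/
def reflStep (v w : W) : Prop :=
  ∃ t, cs.IsReflection t ∧ w = t * v ∧ cs.length v < cs.length w

lemma exists_reduced_sublist (ω : List B) :
    ∃ ω', ω'.Sublist ω ∧ cs.IsReduced ω' ∧ cs.wordProd ω' = cs.wordProd ω := by
  induction ω with
  | nil => exact ⟨[], List.Sublist.refl _, by simp [CoxeterSystem.IsReduced], rfl⟩
  | cons i ω ih =>
    obtain ⟨ω', hs, hr, hp⟩ := ih
    rcases cs.length_simple_mul (cs.wordProd ω') i with h | h
    · refine ⟨i :: ω', hs.cons_cons i, ?_, by rw [cs.wordProd_cons, hp, cs.wordProd_cons]⟩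
      rw [CoxeterSystem.IsReduced, cs.wordProd_cons, h, hr.eq, List.length_cons]
    · obtain ⟨j, hj, he⟩ := strong_exchange cs (cs.isReflection_simple i) (ω := ω') (by omega)
      refine ⟨ω'.eraseIdx j, ((List.eraseIdx_sublist _ _).trans hs).cons i, ?_, ?_⟩
      · rw [CoxeterSystem.IsReduced, ← he, List.length_eraseIdx_of_lt hj]
        rw [hr.eq] at h
        omega
      · rw [← he, hp, cs.wordProd_cons]

lemma simple_mul_chain_or {v w : W} (i : B) (h : Relation.ReflTransGen (reflStep cs) v w) :
    Relation.ReflTransGen (reflStep cs) (cs.simple i * v) w ∨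
      Relation.ReflTransGen (reflStep cs) (cs.simple i * v) (cs.simple i * w) := by
  have hi := cs.isReflection_simple i
  induction h using Relation.ReflTransGen.head_induction_on with
  | refl => exact Or.inr .refl
  | @head x y hxy hyw ih =>
    obtain ⟨t, ht, rfl, hl⟩ := hxy
    by_cases hts : t = cs.simple i
    · subst hts
      exact Or.inl hyw
    rcases lt_or_ge (cs.length (cs.simple i * x)) (cs.length x) with hx | hx
    · refine Or.inl (.head ⟨cs.simple i, hi, by simp, by simpa using hx⟩
        (.head ⟨t, ht, rfl, hl⟩ hyw))
    have hx0 : cs.length x < cs.length (cs.simple i * x) :=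
      lt_of_le_of_ne hx (cs.length_simple_mul_ne x i).symm
    have hstep : reflStep cs (cs.simple i * x) (cs.simple i * (t * x)) := by
      have htr : cs.IsReflection (cs.simple i * t * cs.simple i) := by
        simpa using ht.conj (cs.simple i)
      refine ⟨cs.simple i * t * cs.simple i, htr, by simp [mul_assoc], ?_⟩
      have e : cs.simple i * (t * x) = (cs.simple i * t * cs.simple i) * (cs.simple i * x) := by
        simp [mul_assoc]
      rw [e, ← invParity_eq_zero_iff cs htr, invParity_mul, invParity_simple, if_neg, zero_add]
      · have := (invParity_eq_zero_iff cs ht x).2 hl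
        simpa [mul_assoc] using this
      · intro h
        have h2 := congrArg (fun x => cs.simple i * x * cs.simple i) h
        simp [mul_assoc] at h2
        exact hts h2
    exact ih.imp (.head hstep) (.head hstep)

lemma chain_of_sublist {ω ω' : List B} (hω : cs.IsReduced ω) (h : ω'.Sublist ω) :
    Relation.ReflTransGen (reflStep cs) (cs.wordProd ω') (cs.wordProd ω) := by
  induction h with
  | slnil => exact .refl
  | @cons l₁ l₂ i hs ih =>
    have hr : cs.IsReduced l₂ := hω.drop 1
    refine (ih hr).tail ⟨cs.simple i, cs.isReflection_simple i, cs.wordProd_cons i l₂, ?_⟩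
    rw [hω.eq, hr.eq, List.length_cons]
    omega
  | @cons_cons l₁ l₂ i hs ih =>
    have hr : cs.IsReduced l₂ := hω.drop 1
    rw [cs.wordProd_cons, cs.wordProd_cons]
    refine (simple_mul_chain_or cs i (ih hr)).elim (fun h => h.tail ?_) id
    refine ⟨cs.simple i, cs.isReflection_simple i, rfl, ?_⟩
    rw [← cs.wordProd_cons, hω.eq, hr.eq, List.length_cons]
    omega

lemma exists_sublist_of_chain {v w : W} (h : Relation.ReflTransGen (reflStep cs) v w)
    {ω : List B} (hω : cs.IsReduced ω) (hw : cs.wordProd ω = w) :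
    ∃ ω', ω'.Sublist ω ∧ cs.wordProd ω' = v := by
  induction h generalizing ω with
  | refl => exact ⟨ω, .refl _, hw⟩
  | tail _ hs ih =>
    obtain ⟨t, ht, rfl, hl⟩ := hs
    obtain ⟨j, hj, he⟩ := strong_exchange cs ht (ω := ω)
      (by rw [hw, ← mul_assoc, ht.mul_self, one_mul]; exact hl)
    rw [hw, ← mul_assoc, ht.mul_self, one_mul] at he
    obtain ⟨ω₁, hs₁, hr₁, hp₁⟩ := exists_reduced_sublist cs (ω.eraseIdx j)
    obtain ⟨ω', hs', hp'⟩ := ih hr₁ (hp₁.trans he.symm)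
    exact ⟨ω', (hs'.trans hs₁).trans (List.eraseIdx_sublist _ _), hp'⟩

lemma bruhatLE_iff_chain {v w : W} :
    bruhatLE cs v w ↔ Relation.ReflTransGen (reflStep cs) v w := by
  constructor
  · rintro ⟨ω, hω, rfl, ω', hs, rfl⟩
    exact chain_of_sublist cs hω hs
  · intro h
    obtain ⟨ω, hω, hw⟩ := cs.exists_isReduced w
    exact ⟨ω, hω, hw.symm, exists_sublist_of_chain cs h hω hw.symm⟩

variable {cs}

lemma bruhatLE.refl (w : W) : bruhatLE cs w w := (bruhatLE_iff_chain cs).2 .refl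

lemma bruhatLE.trans {u v w : W} (h₁ : bruhatLE cs u v) (h₂ : bruhatLE cs v w) :
    bruhatLE cs u w := by
  rw [bruhatLE_iff_chain] at *
  exact h₁.trans h₂

lemma bruhatLE.length_le {v w : W} (h : bruhatLE cs v w) : cs.length v ≤ cs.length w := by
  obtain ⟨ω, hω, rfl, ω', hs, rfl⟩ := h
  rw [hω.eq]
  exact (cs.length_wordProd_le ω').trans hs.length_le

lemma bruhatLE.inv {v w : W} (h : bruhatLE cs v w) : bruhatLE cs v⁻¹ w⁻¹ := by
  obtain ⟨ω, hω, rfl, ω', hs, rfl⟩ := h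
  exact ⟨ω.reverse, hω.reverse, cs.wordProd_reverse ω, ω'.reverse, hs.reverse,
    cs.wordProd_reverse ω'⟩

lemma bruhatLE_reflection_mul {t v : W} (ht : cs.IsReflection t)
    (h : cs.length v < cs.length (t * v)) : bruhatLE cs v (t * v) :=
  (bruhatLE_iff_chain cs).2 (.single ⟨t, ht, rfl, h⟩)

lemma bruhatLE_simple_mul {i : B} {v : W} (h : cs.length v < cs.length (cs.simple i * v)) :
    bruhatLE cs v (cs.simple i * v) :=
  bruhatLE_reflection_mul (cs.isReflection_simple i) h

lemma simple_mul_bruhatLE {i : B} {v : W} (h : cs.length (cs.simple i * v) < cs.length v) :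
    bruhatLE cs (cs.simple i * v) v := by
  have h' := bruhatLE_simple_mul (cs := cs) (i := i) (v := cs.simple i * v) (by simpa using h)
  simpa using h'

lemma mul_simple_bruhatLE {i : B} {v : W} (h : cs.length (v * cs.simple i) < cs.length v) :
    bruhatLE cs (v * cs.simple i) v := by
  have h' : cs.length (cs.simple i * v⁻¹) < cs.length v⁻¹ := by
    rwa [← cs.length_inv (v * cs.simple i), ← cs.length_inv v, mul_inv_rev,
      cs.inv_simple] at h
  simpa using (simple_mul_bruhatLE h').inv

lemma bruhatLE.simple_mul {i : B} {v w : W} (h : bruhatLE cs v w)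
    (hw : cs.length w < cs.length (cs.simple i * w)) :
    bruhatLE cs (cs.simple i * v) (cs.simple i * w) := by
  rcases simple_mul_chain_or cs i ((bruhatLE_iff_chain cs).1 h) with h | h
  · exact ((bruhatLE_iff_chain cs).2 h).trans (bruhatLE_simple_mul hw)
  · exact (bruhatLE_iff_chain cs).2 h

lemma bruhatLE.mul_simple {i : B} {v w : W} (h : bruhatLE cs v w)
    (hw : cs.length w < cs.length (w * cs.simple i)) :
    bruhatLE cs (v * cs.simple i) (w * cs.simple i) := by
  have hw' : cs.length w⁻¹ < cs.length (cs.simple i * w⁻¹) := by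
    rwa [← cs.length_inv w, ← cs.length_inv (w * cs.simple i), mul_inv_rev,
      cs.inv_simple] at hw
  simpa using (h.inv.simple_mul hw').inv

lemma bruhatLE.le_or_simple_mul_le {i : B} {v w : W} (h : bruhatLE cs v (cs.simple i * w))
    (hw : cs.length w < cs.length (cs.simple i * w)) :
    bruhatLE cs v w ∨ bruhatLE cs (cs.simple i * v) w := by
  obtain ⟨ω, hω, rfl⟩ := cs.exists_isReduced w
  have hr : cs.IsReduced (i :: ω) := by
    rw [CoxeterSystem.IsReduced, cs.wordProd_cons, List.length_cons, ← hω.eq]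
    have := cs.length_simple_mul (cs.wordProd ω) i
    omega
  obtain ⟨ω', hs, rfl⟩ := exists_sublist_of_chain cs ((bruhatLE_iff_chain cs).1 h) hr
    (cs.wordProd_cons i ω)
  cases hs with
  | cons _ hs => exact Or.inl ⟨ω, hω, rfl, _, hs, rfl⟩
  | cons_cons _ hs => exact Or.inr ⟨ω, hω, rfl, _, hs, by simp [cs.wordProd_cons]⟩

/-- Lifting property: a non-descent of the lower element. -/
lemma bruhatLE.of_lt {i : B} {v w : W} (h : bruhatLE cs v (cs.simple i * w))
    (hw : cs.length w < cs.length (cs.simple i * w))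
    (hv : cs.length v < cs.length (cs.simple i * v)) : bruhatLE cs v w :=
  (h.le_or_simple_mul_le hw).elim id (bruhatLE_simple_mul hv).trans

/-- Lifting property: a common descent. -/
lemma bruhatLE.simple_mul_of_lt {i : B} {v w : W} (h : bruhatLE cs v (cs.simple i * w))
    (hw : cs.length w < cs.length (cs.simple i * w))
    (hv : cs.length (cs.simple i * v) < cs.length v) : bruhatLE cs (cs.simple i * v) w :=
  (h.le_or_simple_mul_le hw).elim (simple_mul_bruhatLE hv).trans id

lemma bruhatLE.simple_mul_le {i : B} {v w : W} (h : bruhatLE cs v w)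
    (hw : cs.length (cs.simple i * w) < cs.length w) : bruhatLE cs (cs.simple i * v) w := by
  have hw' : cs.length (cs.simple i * w) < cs.length (cs.simple i * (cs.simple i * w)) := by
    simpa using hw
  have h' : bruhatLE cs v (cs.simple i * (cs.simple i * w)) := by simpa using h
  rcases h'.le_or_simple_mul_le hw' with h | h
  · simpa using h.simple_mul hw'
  · exact h.trans (simple_mul_bruhatLE hw)

lemma bruhatLE_inv_mul {i : B} {u b : W} (hu : cs.length u < cs.length (cs.simple i * u))
    (hb : cs.length b < cs.length (cs.simple i * b)) :
    bruhatLE cs (u⁻¹ * b) (u⁻¹ * (cs.simple i * b)) := by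
  have e : u⁻¹ * (cs.simple i * b) = (u⁻¹ * cs.simple i * u) * (u⁻¹ * b) := by group
  have h := length_inv_mul_lt cs hu hb
  rw [e] at h ⊢
  exact bruhatLE_reflection_mul (by simpa using (cs.isReflection_simple i).conj u⁻¹) h

/-! ### Minimal coset representatives -/

/-- `x` is the minimal representative of `x W_J`, expressed through additivity of lengths. -/
def IsMinRep (cs : CoxeterSystem M W) (J : Set B) (x : W) : Prop :=
  ∀ u ∈ parabolic cs J, cs.length (x * u) = cs.length x + cs.length u

variable {J : Set B}

lemma exists_word_length_mul {x : W}
    (hx : ∀ u ∈ parabolic cs J, cs.length x ≤ cs.length (x * u)) {u : W}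
    (hu : u ∈ parabolic cs J) :
    ∃ ω : List B, cs.wordProd ω = u ∧ cs.length (x * u) = cs.length x + ω.length := by
  have step : ∀ u ∈ parabolic cs J, ∀ j, cs.simple j ∈ parabolic cs J →
      (∃ ω : List B, cs.wordProd ω = u ∧ cs.length (x * u) = cs.length x + ω.length) →
      ∃ ω : List B, cs.wordProd ω = u * cs.simple j ∧
        cs.length (x * (u * cs.simple j)) = cs.length x + ω.length := by
    rintro u hu j hj ⟨ω, rfl, hl⟩
    rcases cs.length_mul_simple (x * cs.wordProd ω) j with h | h
    · refine ⟨ω ++ [j], by simp [cs.wordProd_append], ?_⟩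
      rw [← mul_assoc, h, hl, List.length_append, List.length_singleton]
      ring
    obtain ⟨α, hα, hxα⟩ := cs.exists_isReduced x
    have ht := (cs.isReflection_simple j).conj (x * cs.wordProd ω)
    have e : x * cs.wordProd ω * cs.simple j * (x * cs.wordProd ω)⁻¹ * cs.wordProd (α ++ ω) =
        x * cs.wordProd ω * cs.simple j := by
      rw [cs.wordProd_append, ← hxα, inv_mul_cancel_right]
    obtain ⟨k, hk, he⟩ := strong_exchange cs ht (ω := α ++ ω) (by
      rw [e, cs.wordProd_append, ← hxα]
      omega)
    rw [e] at he
    rw [List.length_append] at hk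
    rcases lt_or_ge k α.length with hkα | hkα
    · rw [List.eraseIdx_append_of_lt_length hkα, cs.wordProd_append,
        ← mul_inv_eq_iff_eq_mul] at he
      have h1 := hx _ (mul_mem (mul_mem hu hj) (inv_mem hu))
      rw [← mul_assoc, ← mul_assoc, he] at h1
      have h2 := cs.length_wordProd_le (α.eraseIdx k)
      rw [List.length_eraseIdx_of_lt hkα] at h2
      rw [hxα, hα.eq] at h1
      omega
    · rw [List.eraseIdx_append_of_length_le hkα, cs.wordProd_append, ← hxα, mul_assoc,
        mul_right_inj] at he
      refine ⟨ω.eraseIdx (k - α.length), he.symm, ?_⟩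
      rw [← mul_assoc, List.length_eraseIdx_of_lt (by omega)]
      omega
  induction hu using Subgroup.closure_induction_right with
  | one => exact ⟨[], by simp, by simp⟩
  | mul_right u hu r hr ih =>
    obtain ⟨j, hj, rfl⟩ := hr
    exact step u hu j (Subgroup.subset_closure ⟨j, hj, rfl⟩) ih
  | mul_inv_cancel u hu r hr ih =>
    obtain ⟨j, hj, rfl⟩ := hr
    rw [cs.inv_simple]
    exact step u hu j (Subgroup.subset_closure ⟨j, hj, rfl⟩) ih

lemma isMinRep_of_le {x : W}
    (hx : ∀ u ∈ parabolic cs J, cs.length x ≤ cs.length (x * u)) : IsMinRep cs J x := by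
  intro u hu
  obtain ⟨ω, rfl, hl⟩ := exists_word_length_mul hx hu
  have h1 := cs.length_wordProd_le ω
  have h2 := cs.length_mul_le x (cs.wordProd ω)
  omega

variable (cs J) in
lemma parPart_mem (w : W) : parPart cs J w ∈ parabolic cs J :=
  (exists_minRep cs J w).choose_spec.1

variable (cs J) in
lemma minRep_mul_parPart (w : W) : minRep cs J w * parPart cs J w = w :=
  mul_inv_cancel_left _ _

variable (cs J) in
lemma isMinRep_minRep (w : W) : IsMinRep cs J (minRep cs J w) := by
  refine isMinRep_of_le fun u hu => (exists_minRep cs J w).choose_spec.2 _ ?_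
  rw [mul_inv_rev, mul_assoc]
  exact mul_mem (inv_mem hu) (parPart_mem cs J w)

lemma IsMinRep.minRep_mul {y b : W} (hy : IsMinRep cs J y) (hb : b ∈ parabolic cs J) :
    minRep cs J (y * b) = y := by
  have hu : parPart cs J (y * b) * b⁻¹ ∈ parabolic cs J :=
    mul_mem (parPart_mem cs J _) (inv_mem hb)
  have e : minRep cs J (y * b) * (parPart cs J (y * b) * b⁻¹) = y := by
    rw [← mul_assoc, minRep_mul_parPart, mul_inv_cancel_right]
  have h1 := isMinRep_minRep cs J (y * b) _ hu
  have h2 := (exists_minRep cs J (y * b)).choose_spec.2 y (by simpa using hb)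
  have h3 := hy _ (inv_mem hu)
  rw [mul_inv_eq_of_eq_mul e.symm] at h3
  rw [e] at h1
  have h4 : parPart cs J (y * b) * b⁻¹ = 1 := cs.length_eq_zero_iff.mp (by
    rw [cs.length_inv] at h3
    omega)
  rwa [h4, mul_one] at e

lemma IsMinRep.parPart_mul {y b : W} (hy : IsMinRep cs J y) (hb : b ∈ parabolic cs J) :
    parPart cs J (y * b) = b := by
  rw [parPart, hy.minRep_mul hb, inv_mul_cancel_left]

lemma twistedLE_mul_iff {x y a b : W} (hy : IsMinRep cs J y) (hb : b ∈ parabolic cs J)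
    (hx : IsMinRep cs J x) (ha : a ∈ parabolic cs J) :
    twistedLE cs J (y * b) (x * a) ↔
      ∃ u ∈ parabolic cs J, bruhatLE cs (y * u) x ∧ bruhatLE cs a (u⁻¹ * b) := by
  rw [twistedLE, hy.minRep_mul hb, hy.parPart_mul hb, hx.minRep_mul ha, hx.parPart_mul ha]

/-- Left multiplication by a simple reflection either preserves minimality of a coset
representative or is a right multiplication by a simple reflection in `W_J`. -/
lemma IsMinRep.simple_mul {z : W} (hz : IsMinRep cs J z) (i : B) :
    IsMinRep cs J (cs.simple i * z) ∨
      ∃ j, cs.simple j ∈ parabolic cs J ∧ cs.simple i * z = z * cs.simple j := by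
  by_contra! hn
  obtain ⟨h1, h2⟩ := hn
  refine h1 (isMinRep_of_le fun u hu => ?_)
  by_contra! hlt
  have hzu := hz u hu
  rw [mul_assoc] at hlt
  have h3 := cs.length_simple_mul (z * u) i
  have h4 := cs.length_simple_mul z i
  have hu1 : u ≠ 1 := by
    rintro rfl
    simp at hlt
  have hu0 := mt cs.length_eq_zero_iff.mp hu1
  obtain ⟨j, rfl⟩ := cs.length_eq_one_iff.mp (show cs.length u = 1 by omega)
  exact h2 j hu (simple_mul_eq_mul_simple cs (by omega) (by omega))

/-! ### The Demazure-type operator -/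

lemma circL_mul_of_lt {i : B} {z c : W} (hz : IsMinRep cs J z) (hc : c ∈ parabolic cs J)
    (hs : IsMinRep cs J (cs.simple i * z)) (h : cs.length (cs.simple i * z) < cs.length z) :
    circL cs J i (z * c) = cs.simple i * z * c := by
  rw [circL, if_pos, mul_assoc]
  rw [← mul_assoc, twistedLE_mul_iff hs hc hz hc]
  exact ⟨1, one_mem _, by simpa using simple_mul_bruhatLE h, by simpa using bruhatLE.refl c⟩

lemma circL_mul_of_gt {i : B} {z c : W} (hz : IsMinRep cs J z) (hc : c ∈ parabolic cs J)
    (hs : IsMinRep cs J (cs.simple i * z)) (h : cs.length z < cs.length (cs.simple i * z)) :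
    circL cs J i (z * c) = z * c := by
  rw [circL, if_neg]
  rw [← mul_assoc, twistedLE_mul_iff hs hc hz hc]
  rintro ⟨u, hu, h1, -⟩
  have h2 := h1.length_le
  rw [hs u hu] at h2
  omega

lemma circL_mul_of_par_gt {i j : B} {z c : W} (hz : IsMinRep cs J z) (hc : c ∈ parabolic cs J)
    (hj : cs.simple j ∈ parabolic cs J) (he : cs.simple i * z = z * cs.simple j)
    (h : cs.length c < cs.length (cs.simple j * c)) :
    circL cs J i (z * c) = z * (cs.simple j * c) := by
  have e : cs.simple i * (z * c) = z * (cs.simple j * c) := by rw [← mul_assoc, he, mul_assoc]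
  rw [circL, if_pos, e]
  rw [e, twistedLE_mul_iff hz (mul_mem hj hc) hz hc]
  exact ⟨1, one_mem _, by simpa using bruhatLE.refl z, by simpa using bruhatLE_simple_mul h⟩

lemma circL_mul_of_par_lt {i j : B} {z c : W} (hz : IsMinRep cs J z) (hc : c ∈ parabolic cs J)
    (hj : cs.simple j ∈ parabolic cs J) (he : cs.simple i * z = z * cs.simple j)
    (h : cs.length (cs.simple j * c) < cs.length c) :
    circL cs J i (z * c) = z * c := by
  have e : cs.simple i * (z * c) = z * (cs.simple j * c) := by rw [← mul_assoc, he, mul_assoc]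
  rw [circL, if_neg]
  rw [e, twistedLE_mul_iff hz (mul_mem hj hc) hz hc]
  rintro ⟨u, hu, h1, h2⟩
  have h3 := h1.length_le
  rw [hz u hu] at h3
  obtain rfl := cs.length_eq_zero_iff.mp (show cs.length u = 0 by omega)
  have h4 := h2.length_le
  rw [inv_one, one_mul] at h4
  omega

lemma length_lt_or_simple_mul_lt (cs : CoxeterSystem M W) (i : B) (w : W) :
    cs.length w < cs.length (cs.simple i * w) ∨ cs.length (cs.simple i * w) < cs.length w :=
  (cs.length_simple_mul_ne w i).symm.lt_or_gt

lemma length_lt_or_mul_simple_lt (cs : CoxeterSystem M W) (i : B) (w : W) :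
    cs.length w < cs.length (w * cs.simple i) ∨ cs.length (w * cs.simple i) < cs.length w :=
  (cs.length_mul_simple_ne w i).symm.lt_or_gt

/-- When `sᵢ y = y sⱼ`, a witness of `y b ≤^J x a` may be replaced by a witness for
`sᵢ ∘ (y b) ≤^J x a` which does not have `sⱼ` as a left descent. -/
lemma exists_circL_witness {i j : B} {x y a b u : W} (hy : IsMinRep cs J y)
    (hb : b ∈ parabolic cs J) (hj : cs.simple j ∈ parabolic cs J)
    (he : cs.simple i * y = y * cs.simple j) (hu : u ∈ parabolic cs J)
    (hyu : bruhatLE cs (y * u) x) (hab : bruhatLE cs a (u⁻¹ * b)) :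
    ∃ b' ∈ parabolic cs J, ∃ u' ∈ parabolic cs J, circL cs J i (y * b) = y * b' ∧
      cs.length (cs.simple j * b') < cs.length b' ∧
      cs.length u' < cs.length (cs.simple j * u') ∧
      bruhatLE cs (y * u') x ∧ bruhatLE cs a (u'⁻¹ * b') := by
  have hlow : cs.length (cs.simple j * u) < cs.length u →
      bruhatLE cs (y * (cs.simple j * u)) x := by
    intro h
    have e : y * (cs.simple j * u) = cs.simple i * (y * u) := by
      rw [← mul_assoc, ← he, mul_assoc]
    refine bruhatLE.trans ?_ hyu
    rw [e]
    refine simple_mul_bruhatLE ?_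
    rw [← e, hy _ (mul_mem hj hu), hy _ hu]
    omega
  rcases length_lt_or_simple_mul_lt cs j b with hjb | hjb
  · refine ⟨_, mul_mem hj hb, ?_⟩
    rcases length_lt_or_simple_mul_lt cs j u with hju | hju
    · exact ⟨u, hu, circL_mul_of_par_gt hy hb hj he hjb, by simpa using hjb, hju, hyu,
        hab.trans (bruhatLE_inv_mul hju hjb)⟩
    · exact ⟨_, mul_mem hj hu, circL_mul_of_par_gt hy hb hj he hjb, by simpa using hjb,
        by simpa using hju, hlow hju, by simpa [mul_assoc] using hab⟩
  · refine ⟨b, hb, ?_⟩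
    rcases length_lt_or_simple_mul_lt cs j u with hju | hju
    · exact ⟨u, hu, circL_mul_of_par_lt hy hb hj he hjb, hjb, hju, hyu, hab⟩
    · refine ⟨_, mul_mem hj hu, circL_mul_of_par_lt hy hb hj he hjb, hjb, by simpa using hju,
        hlow hju, hab.trans ?_⟩
      have h := bruhatLE_inv_mul (cs := cs) (i := j) (u := cs.simple j * u)
        (b := cs.simple j * b) (by simpa using hju) (by simpa using hjb)
      simpa [mul_assoc] using h

/-- `sᵢ ∘ v ≤^J w` whenever `v ≤^J w`. -/
lemma circL_le_of_le {i : B} {x y a b : W} (hy : IsMinRep cs J y) (hb : b ∈ parabolic cs J)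
    (hx : IsMinRep cs J x) (ha : a ∈ parabolic cs J) (h : twistedLE cs J (y * b) (x * a)) :
    twistedLE cs J (circL cs J i (y * b)) (x * a) := by
  obtain ⟨u, hu, hyu, hab⟩ := (twistedLE_mul_iff hy hb hx ha).1 h
  rcases hy.simple_mul i with hsy | ⟨j, hj, he⟩
  · rcases length_lt_or_simple_mul_lt cs i y with hl | hl
    · rwa [circL_mul_of_gt hy hb hsy hl]
    · rw [circL_mul_of_lt hy hb hsy hl, twistedLE_mul_iff hsy hb hx ha]
      refine ⟨u, hu, bruhatLE.trans ?_ hyu, hab⟩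
      rw [mul_assoc]
      refine simple_mul_bruhatLE ?_
      rw [← mul_assoc, hsy u hu, hy u hu]
      omega
  · obtain ⟨b', hb', u', hu', hc, -, -, h1, h2⟩ := exists_circL_witness hy hb hj he hu hyu hab
    rw [hc, twistedLE_mul_iff hy hb' hx ha]
    exact ⟨u', hu', h1, h2⟩

/-- Monotonicity when `sᵢ` is a descent of the minimal representative of the upper element. -/
lemma circL_le_simple_mul {i : B} {x y a b : W} (hy : IsMinRep cs J y)
    (hb : b ∈ parabolic cs J) (hx : IsMinRep cs J x) (ha : a ∈ parabolic cs J)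
    (hsx : IsMinRep cs J (cs.simple i * x)) (hlx : cs.length (cs.simple i * x) < cs.length x)
    (h : twistedLE cs J (y * b) (x * a)) :
    twistedLE cs J (circL cs J i (y * b)) (cs.simple i * x * a) := by
  obtain ⟨u, hu, hyu, hab⟩ := (twistedLE_mul_iff hy hb hx ha).1 h
  have hx1 : cs.simple i * (cs.simple i * x) = x := by simp
  have hlx' : cs.length (cs.simple i * x) < cs.length (cs.simple i * (cs.simple i * x)) := by
    rwa [hx1]
  rcases hy.simple_mul i with hsy | ⟨j, hj, he⟩
  · have h1 := hsy u hu
    have h2 := hy u hu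
    rw [mul_assoc] at h1
    rcases length_lt_or_simple_mul_lt cs i y with hl | hl
    · rw [circL_mul_of_gt hy hb hsy hl, twistedLE_mul_iff hy hb hsx ha]
      exact ⟨u, hu, (hx1.symm ▸ hyu).of_lt hlx' (by omega), hab⟩
    · rw [circL_mul_of_lt hy hb hsy hl, twistedLE_mul_iff hsy hb hsx ha]
      refine ⟨u, hu, ?_, hab⟩
      rw [mul_assoc]
      exact (hx1.symm ▸ hyu).simple_mul_of_lt hlx' (by omega)
  · obtain ⟨b', hb', u', hu', hc, -, hlu, h1, h2⟩ := exists_circL_witness hy hb hj he hu hyu hab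
    rw [hc, twistedLE_mul_iff hy hb' hsx ha]
    refine ⟨u', hu', (hx1.symm ▸ h1).of_lt hlx' ?_, h2⟩
    rw [← mul_assoc, he, mul_assoc, hy _ (mul_mem hj hu'), hy _ hu']
    omega

/-- Monotonicity when `sᵢ x = x sₖ`, with `sₖ` multiplied onto the parabolic part of the upper
element. -/
lemma circL_le_mul_simple {i k : B} {x y a b : W} (hy : IsMinRep cs J y)
    (hb : b ∈ parabolic cs J) (hx : IsMinRep cs J x) (ha : a ∈ parabolic cs J)
    (hk : cs.simple k ∈ parabolic cs J) (hex : cs.simple i * x = x * cs.simple k)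
    (h : twistedLE cs J (y * b) (x * a)) :
    twistedLE cs J (circL cs J i (y * b)) (x * (cs.simple k * a)) := by
  obtain ⟨u, hu, hyu, hab⟩ := (twistedLE_mul_iff hy hb hx ha).1 h
  have hka := mul_mem hk ha
  have hlx : cs.length x < cs.length (x * cs.simple k) := by
    rw [hx _ hk, cs.length_simple]
    omega
  have hlx' : cs.length x < cs.length (cs.simple i * x) := by rwa [hex]
  have hlift : ∀ {g : W}, bruhatLE cs a g → cs.length (cs.simple k * g) < cs.length g →
      bruhatLE cs (cs.simple k * a) g := fun hag hg => hag.simple_mul_le hg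
  have hup : ∀ {u g : W}, bruhatLE cs a (u⁻¹ * g) →
      cs.length (u⁻¹ * g) < cs.length (cs.simple k * (u⁻¹ * g)) →
      bruhatLE cs (cs.simple k * a) ((u * cs.simple k)⁻¹ * g) := by
    intro u g hag hg
    simpa [mul_assoc] using hag.simple_mul hg
  have hmul : ∀ {p : W}, bruhatLE cs p x → bruhatLE cs (p * cs.simple k) (cs.simple i * x) := by
    intro p hp
    rw [hex]
    exact hp.mul_simple hlx
  have hdown : ∀ {p : W}, bruhatLE cs p x → cs.length (p * cs.simple k) < cs.length p →
      bruhatLE cs (p * cs.simple k) x := fun hp hlt => (mul_simple_bruhatLE hlt).trans hp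
  have huk := mul_mem hu hk
  have e1 := hy u hu
  have e2 := hy _ huk
  rcases hy.simple_mul i with hsy | ⟨j, hj, he⟩
  · have e3 := hsy u hu
    have e4 := hsy _ huk
    simp only [← mul_assoc] at e2 e3 e4
    rcases length_lt_or_simple_mul_lt cs i y with hl | hl
    · rw [circL_mul_of_gt hy hb hsy hl, twistedLE_mul_iff hy hb hx hka]
      rcases length_lt_or_simple_mul_lt cs k (u⁻¹ * b) with hg | hg
      · refine ⟨_, huk, ?_, hup hab hg⟩
        rw [← mul_assoc]
        rcases length_lt_or_mul_simple_lt cs k u with hlu | hlu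
        · refine (hmul hyu).of_lt hlx' ?_
          rw [← mul_assoc, ← mul_assoc]
          omega
        · exact hdown hyu (by omega)
      · exact ⟨u, hu, hyu, hlift hab hg⟩
    · rw [circL_mul_of_lt hy hb hsy hl, twistedLE_mul_iff hsy hb hx hka]
      have hsyu : bruhatLE cs (cs.simple i * y * u) x := by
        rw [mul_assoc]
        refine (simple_mul_bruhatLE ?_).trans hyu
        rw [← mul_assoc]
        omega
      rcases length_lt_or_simple_mul_lt cs k (u⁻¹ * b) with hg | hg
      · refine ⟨_, huk, ?_, hup hab hg⟩
        rw [← mul_assoc]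
        rcases length_lt_or_mul_simple_lt cs k u with hlu | hlu
        · have h5 := (hmul hyu).simple_mul_of_lt hlx' (by
            rw [← mul_assoc, ← mul_assoc]
            omega)
          simpa only [← mul_assoc] using h5
        · exact hdown hsyu (by omega)
      · exact ⟨u, hu, hsyu, hlift hab hg⟩
  · clear e1 e2 huk
    obtain ⟨b', hb', u', hu', hc, hlb, hlu, h1, h2⟩ :=
      exists_circL_witness hy hb hj he hu hyu hab
    have huk := mul_mem hu' hk
    rw [hc, twistedLE_mul_iff hy hb' hx hka]
    rcases length_lt_or_simple_mul_lt cs k (u'⁻¹ * b') with hg | hg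
    · refine ⟨_, huk, ?_, hup h2 hg⟩
      rw [← mul_assoc]
      rcases length_lt_or_mul_simple_lt cs k u' with hluk | hluk
      · refine (hmul h1).of_lt hlx' ?_
        rw [← mul_assoc, ← mul_assoc, he, mul_assoc, mul_assoc, mul_assoc,
          hy _ (mul_mem hj huk), hy _ huk]
        rcases length_lt_or_simple_mul_lt cs j (u' * cs.simple k) with h3 | h3
        · omega
        · have h4 := simple_mul_eq_mul_simple cs hlu h3
          have h5 := length_inv_mul_lt cs (b := cs.simple j * b') hlu (by simpa using hlb)
          have h6 : cs.simple k * u'⁻¹ = u'⁻¹ * cs.simple j := by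
            simpa using (congrArg (·⁻¹) h4).symm
          rw [← mul_assoc, h6, mul_assoc] at hg
          rw [cs.simple_mul_simple_cancel_left] at h5
          omega
      · refine hdown h1 ?_
        rw [mul_assoc, hy _ huk, hy _ hu']
        omega
    · exact ⟨u', hu', h1, hlift h2 hg⟩

variable (cs)

/-- If `v ≤^J w` then `s_i ∘_l^J v ≤^J s_i ∘_l^J w`. -/
theorem circL_mono (J : Set B) (i : B) (v w : W) (hvw : twistedLE cs J v w) :
    twistedLE cs J (circL cs J i v) (circL cs J i w) := by
  have hy := isMinRep_minRep cs J v
  have hb := parPart_mem cs J v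
  have hx := isMinRep_minRep cs J w
  have ha := parPart_mem cs J w
  rw [← minRep_mul_parPart cs J v, ← minRep_mul_parPart cs J w] at hvw ⊢
  generalize minRep cs J v = y at *
  generalize parPart cs J v = b at *
  generalize minRep cs J w = x at *
  generalize parPart cs J w = a at *
  rcases hx.simple_mul i with hsx | ⟨k, hk, he⟩
  · rcases length_lt_or_simple_mul_lt cs i x with hl | hl
    · rw [circL_mul_of_gt hx ha hsx hl]
      exact circL_le_of_le hy hb hx ha hvw
    · rw [circL_mul_of_lt hx ha hsx hl]
      exact circL_le_simple_mul hy hb hx ha hsx hl hvw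
  · rcases length_lt_or_simple_mul_lt cs k a with hl | hl
    · rw [circL_mul_of_par_gt hx ha hk he hl]
      exact circL_le_mul_simple hy hb hx ha hk he hvw
    · rw [circL_mul_of_par_lt hx ha hk he hl]
      exact circL_le_of_le hy hb hx ha hvw

end TwistedTP
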